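/- For every ultrafilter U on ℝⁿ × ℝⁿ, the map T_U : B⁰(H) → B⁰(H), defined by taking the *-strong limit T_U(S) of T_X(S) along U, is a unital *-homomorphism: it is linear, satisfies T_U(S S') = T_U(S) T_U(S'), T_U(S*) = T_U(S)*, T_U(1) = 1, and is norm-decreasing: ‖T_U(S)‖ ≤ ‖S‖. -/

import Mathlib

open MeasureTheory Filter Topology Matrix
open scoped Pointwise

noncomputable section

/-- Phase space `Ξ = ℝⁿ × (ℝⁿ)*`. -/
abbrev Xi (n : ℕ) := (Fin n → ℝ) × (Fin n → ℝ)

/-- The Hilbert space `H = L²(ℝⁿ, ℂ)`. -/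
abbrev Hn (n : ℕ) := Lp ℂ 2 (volume : Measure (Fin n → ℝ))

/-- `W` is the family of operators given by
`(W(x,ξ)u)(y) = exp(i (y - x/2)·ξ) u(y - x)` (almost everywhere). -/
def IsWeylFamily (n : ℕ) (W : Xi n → (Hn n →L[ℂ] Hn n)) : Prop :=
  ∀ (x ξ : Fin n → ℝ) (u : Hn n), ∀ᵐ y ∂(volume : Measure (Fin n → ℝ)),
    W (x, ξ) u y
      = Complex.exp (Complex.I * (((y - (2⁻¹ : ℝ) • x) ⬝ᵥ ξ : ℝ) : ℂ)) * u (y - x)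

/-- Conjugation `T_X(S) := W(X) S W(X)*`. -/
def Tconj (n : ℕ) (W : Xi n → (Hn n →L[ℂ] Hn n)) (X : Xi n)
    (S : Hn n →L[ℂ] Hn n) : Hn n →L[ℂ] Hn n :=
  W X * S * star (W X)

/-- `B⁰(H)`: the set of `S` whose orbit `X ↦ T_X(S)` is norm-continuous. -/
def B0 (n : ℕ) (W : Xi n → (Hn n →L[ℂ] Hn n)) : Set (Hn n →L[ℂ] Hn n) :=
  {S | Continuous fun X : Xi n => Tconj n W X S}

/-- `A` is the limit of `T_X(S)` along the filter `F` in the *-strong operator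
topology. -/
def StarStrongLim (n : ℕ) (W : Xi n → (Hn n →L[ℂ] Hn n)) (F : Filter (Xi n))
    (S A : Hn n →L[ℂ] Hn n) : Prop :=
  ∀ u : Hn n,
    Tendsto (fun X : Xi n => Tconj n W X S u) F (𝓝 (A u)) ∧
    Tendsto (fun X : Xi n => star (Tconj n W X S) u) F (𝓝 (star A u))

/-- Weyl operators commute up to a phase factor. -/
theorem IsWeylFamily.exists_mul_eq_smul {n : ℕ} {W : Xi n → (Hn n →L[ℂ] Hn n)}
    (hW : IsWeylFamily n W) (X Y : Xi n) :
    ∃ c : ℂ, c * star c = 1 ∧ W X * W Y = c • (W Y * W X) := by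
  have comp : ∀ (x ξ y η : Fin n → ℝ) (u : Hn n), ∀ᵐ z ∂(volume : Measure (Fin n → ℝ)),
      W (x, ξ) (W (y, η) u) z
        = Complex.exp (Complex.I * (((z - (2⁻¹ : ℝ) • x) ⬝ᵥ ξ : ℝ) : ℂ))
          * (Complex.exp (Complex.I * (((z - x - (2⁻¹ : ℝ) • y) ⬝ᵥ η : ℝ) : ℂ))
            * u (z - x - y)) := by
    intro x ξ y η u
    have h := (measurePreserving_sub_right (volume : Measure (Fin n → ℝ))
      x).quasiMeasurePreserving.ae (hW y η u)
    filter_upwards [hW x ξ (W (y, η) u), h] with z h₁ h₂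
    rw [h₁, h₂]
  obtain ⟨x, ξ⟩ := X
  obtain ⟨y, η⟩ := Y
  refine ⟨Complex.exp (Complex.I * ((y ⬝ᵥ ξ - x ⬝ᵥ η : ℝ) : ℂ)), ?_, ?_⟩
  · rw [Complex.star_def, ← Complex.exp_conj, ← Complex.exp_add, map_mul, Complex.conj_I,
      Complex.conj_ofReal, neg_mul, add_neg_cancel, Complex.exp_zero]
  · ext u
    change W (x, ξ) (W (y, η) u) =ᵐ[volume] (Complex.exp _ • W (y, η) (W (x, ξ) u) : Hn n)
    filter_upwards [comp x ξ y η u, comp y η x ξ u,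
      Lp.coeFn_smul (Complex.exp (Complex.I * ((y ⬝ᵥ ξ - x ⬝ᵥ η : ℝ) : ℂ)))
        (W (y, η) (W (x, ξ) u))] with z h₁ h₂ h₃
    rw [h₁, h₃, Pi.smul_apply, h₂, sub_right_comm z y x, smul_eq_mul, ← mul_assoc, ← mul_assoc,
      ← mul_assoc, ← Complex.exp_add, ← Complex.exp_add, ← Complex.exp_add]
    congr 2
    simp only [sub_dotProduct, smul_dotProduct, Complex.ofReal_sub]
    ring

section Conjugation

variable {n : ℕ} {W : Xi n → (Hn n →L[ℂ] Hn n)}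

theorem Tconj_comm (hW : IsWeylFamily n W) (X Y : Xi n) (S : Hn n →L[ℂ] Hn n) :
    Tconj n W X (Tconj n W Y S) = Tconj n W Y (Tconj n W X S) := by
  obtain ⟨c, hc, h⟩ := hW.exists_mul_eq_smul X Y
  have expand : ∀ X Y : Xi n, Tconj n W X (Tconj n W Y S)
      = (W X * W Y) * S * star (W X * W Y) := fun X Y => by
    simp only [Tconj, star_mul, mul_assoc]
  rw [expand, expand, h, star_smul, smul_mul_assoc, smul_mul_assoc, mul_smul_comm, smul_smul, hc,
    one_smul]

theorem Tconj_add (X : Xi n) (S S' : Hn n →L[ℂ] Hn n) :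
    Tconj n W X (S + S') = Tconj n W X S + Tconj n W X S' := by
  simp only [Tconj, mul_add, add_mul]

theorem Tconj_sub (X : Xi n) (S S' : Hn n →L[ℂ] Hn n) :
    Tconj n W X (S - S') = Tconj n W X S - Tconj n W X S' := by
  simp only [Tconj, mul_sub, sub_mul]

theorem Tconj_smul (X : Xi n) (c : ℂ) (S : Hn n →L[ℂ] Hn n) :
    Tconj n W X (c • S) = c • Tconj n W X S := by
  simp only [Tconj, mul_smul_comm, smul_mul_assoc]

theorem Tconj_star (X : Xi n) (S : Hn n →L[ℂ] Hn n) :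
    Tconj n W X (star S) = star (Tconj n W X S) := by
  simp only [Tconj, star_mul, star_star, mul_assoc]

theorem Tconj_mul (hWU : ∀ X : Xi n, W X ∈ unitary (Hn n →L[ℂ] Hn n))
    (X : Xi n) (S S' : Hn n →L[ℂ] Hn n) :
    Tconj n W X (S * S') = Tconj n W X S * Tconj n W X S' := by
  simp only [Tconj, mul_assoc]
  rw [← mul_assoc (star (W X)) (W X), Unitary.star_mul_self_of_mem (hWU X), one_mul]

theorem Tconj_one (hWU : ∀ X : Xi n, W X ∈ unitary (Hn n →L[ℂ] Hn n))
    (X : Xi n) : Tconj n W X 1 = 1 := by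
  rw [Tconj, mul_one, Unitary.mul_star_self_of_mem (hWU X)]

theorem norm_Tconj (hWU : ∀ X : Xi n, W X ∈ unitary (Hn n →L[ℂ] Hn n))
    (X : Xi n) (S : Hn n →L[ℂ] Hn n) : ‖Tconj n W X S‖ = ‖S‖ := by
  rw [Tconj, CStarRing.norm_mul_mem_unitary _ (Unitary.star_mem (hWU X)),
    CStarRing.norm_mem_unitary_mul _ (hWU X)]

theorem norm_le_of_tendsto_Tconj (hWU : ∀ X : Xi n, W X ∈ unitary (Hn n →L[ℂ] Hn n))
    {F : Filter (Xi n)} [F.NeBot] {S A : Hn n →L[ℂ] Hn n}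
    (h : ∀ u, Tendsto (fun X => Tconj n W X S u) F (𝓝 (A u))) : ‖A‖ ≤ ‖S‖ := by
  refine A.opNorm_le_bound (norm_nonneg S) fun u => ?_
  refine le_of_tendsto (h u).norm (Eventually.of_forall fun X => ?_)
  exact (ContinuousLinearMap.le_opNorm _ _).trans_eq (by rw [norm_Tconj hWU])

theorem tendsto_Tconj_mul (hWU : ∀ X : Xi n, W X ∈ unitary (Hn n →L[ℂ] Hn n))
    {F : Filter (Xi n)} {S S' A A' : Hn n →L[ℂ] Hn n}
    (h : ∀ u, Tendsto (fun X => Tconj n W X S u) F (𝓝 (A u)))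
    (h' : ∀ u, Tendsto (fun X => Tconj n W X S' u) F (𝓝 (A' u))) (u : Hn n) :
    Tendsto (fun X => Tconj n W X (S * S') u) F (𝓝 ((A * A') u)) := by
  have key : Tendsto (fun X => Tconj n W X S (Tconj n W X S' u - A' u)) F (𝓝 0) := by
    have hlim : Tendsto (fun X => ‖S‖ * ‖Tconj n W X S' u - A' u‖) F (𝓝 0) := by
      simpa using ((h' u).sub_const (A' u)).norm.const_mul ‖S‖
    refine squeeze_zero_norm (fun X => ?_) hlim
    exact (ContinuousLinearMap.le_opNorm _ _).trans_eq (by rw [norm_Tconj hWU])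
  have hsum := key.add (h (A' u))
  simp only [map_sub, sub_add_cancel, zero_add] at hsum
  simp only [Tconj_mul hWU]
  exact hsum

/-- Strong limits of conjugates inherit norm-continuity of the orbit. -/
theorem mem_B0_of_tendsto_Tconj (hWU : ∀ X : Xi n, W X ∈ unitary (Hn n →L[ℂ] Hn n))
    (hW : IsWeylFamily n W) {F : Filter (Xi n)} [F.NeBot]
    {S A : Hn n →L[ℂ] Hn n} (hS : S ∈ B0 n W)
    (h : ∀ u, Tendsto (fun X => Tconj n W X S u) F (𝓝 (A u))) : A ∈ B0 n W := by
  have hconj : ∀ (Y : Xi n) (u : Hn n),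
      Tendsto (fun X => Tconj n W X (Tconj n W Y S) u) F (𝓝 (Tconj n W Y A u)) := by
    intro Y u
    simp only [fun X => Tconj_comm hW X Y S]
    exact ((W Y).continuous.tendsto _).comp (h (star (W Y) u))
  have hle : ∀ Y Z : Xi n,
      ‖Tconj n W Y A - Tconj n W Z A‖ ≤ ‖Tconj n W Y S - Tconj n W Z S‖ := fun Y Z =>
    norm_le_of_tendsto_Tconj hWU (F := F) fun u => by
      simpa only [Tconj_sub, _root_.sub_apply] using (hconj Y u).sub (hconj Z u)
  refine continuous_iff_continuousAt.2 fun Z => ?_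
  refine tendsto_iff_norm_sub_tendsto_zero.2 ?_
  exact squeeze_zero (fun _ => norm_nonneg _) (fun Y => hle Y Z)
    (tendsto_iff_norm_sub_tendsto_zero.1 (continuous_iff_continuousAt.1 hS Z))

end Conjugation

/-- for an ultrafilter `U`, the map `T_U : B⁰(H) → B⁰(H)` given by
the *-strong limit along `U` is a norm-decreasing unital *-homomorphism. -/
theorem statement6 (n : ℕ) (W : Xi n → (Hn n →L[ℂ] Hn n))
    (hW : IsWeylFamily n W) (hWU : ∀ X : Xi n, W X ∈ unitary (Hn n →L[ℂ] Hn n))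
    (U : Ultrafilter (Xi n)) (TU : (Hn n →L[ℂ] Hn n) → (Hn n →L[ℂ] Hn n))
    (hTU : ∀ S ∈ B0 n W, StarStrongLim n W (U : Filter (Xi n)) S (TU S)) :
    (∀ S ∈ B0 n W, TU S ∈ B0 n W) ∧
    (∀ S ∈ B0 n W, ∀ S' ∈ B0 n W, TU (S + S') = TU S + TU S') ∧
    (∀ (c : ℂ), ∀ S ∈ B0 n W, TU (c • S) = c • TU S) ∧
    (∀ S ∈ B0 n W, ∀ S' ∈ B0 n W, TU (S * S') = TU S * TU S') ∧
    (∀ S ∈ B0 n W, TU (star S) = star (TU S)) ∧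
    TU 1 = 1 ∧
    (∀ S ∈ B0 n W, ‖TU S‖ ≤ ‖S‖) := by
  have lim : ∀ S ∈ B0 n W, ∀ u, Tendsto (fun X => Tconj n W X S u) U (𝓝 (TU S u)) :=
    fun S hS u => (hTU S hS u).1
  have uniq : ∀ S ∈ B0 n W, ∀ A : Hn n →L[ℂ] Hn n,
      (∀ u, Tendsto (fun X => Tconj n W X S u) U (𝓝 (A u))) → TU S = A :=
    fun S hS A hA => ContinuousLinearMap.ext fun u => tendsto_nhds_unique (lim S hS u) (hA u)
  refine ⟨fun S hS => mem_B0_of_tendsto_Tconj hWU hW hS (lim S hS), ?_, ?_, ?_, ?_, ?_,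
    fun S hS => norm_le_of_tendsto_Tconj hWU (lim S hS)⟩
  · intro S hS S' hS'
    refine uniq _ ?_ _ fun u => ?_
    · simp only [B0, Set.mem_ofPred_eq, Tconj_add]
      exact Continuous.add hS hS'
    · simp only [Tconj_add]
      exact (lim S hS u).add (lim S' hS' u)
  · intro c S hS
    refine uniq _ ?_ _ fun u => ?_
    · simp only [B0, Set.mem_ofPred_eq, Tconj_smul]
      exact Continuous.const_smul hS c
    · simp only [Tconj_smul]
      exact (lim S hS u).const_smul c
  · intro S hS S' hS'
    refine uniq _ ?_ _ (tendsto_Tconj_mul hWU (lim S hS) (lim S' hS'))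
    simp only [B0, Set.mem_ofPred_eq, Tconj_mul hWU]
    exact Continuous.mul hS hS'
  · intro S hS
    refine uniq _ ?_ _ fun u => ?_
    · simp only [B0, Set.mem_ofPred_eq, Tconj_star]
      exact Continuous.star hS
    · simpa only [Tconj_star] using (hTU S hS u).2
  · refine uniq _ ?_ _ fun u => ?_
    · simp only [B0, Set.mem_ofPred_eq, Tconj_one hWU]
      exact continuous_const
    · simpa only [Tconj_one hWU] using tendsto_const_nhds
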